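/- Suppose m ≥ 2, let p := min{p_1, …, p_m} and let t ∈ [m] be an index with p_t = p. Then for every integer k ≥ 1, the maximum of E(S) over all words S of length k over [m] equals p^{−1} + p^{−2} + ⋯ + p^{−k} = (1 − p^k) / ((1−p) p^k), and this maximum is achieved when S = t^k is the constant word consisting of k copies of t. -/

import Mathlib

/-- The probability of a given finite word over the alphabet `Fin m`, where face `i`
has probability `p i`. -/
def dieP {m : ℕ} (p : Fin m → ℝ) (w : List (Fin m)) : ℝ := (w.map p).prod

/-- The number of occurrences of `S` as a factor (consecutive subword) of `w`. -/
def numOccs {m : ℕ} (S w : List (Fin m)) : ℕ :=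
  ((Finset.range (w.length + 1)).filter fun i => (w.drop i).take S.length = S).card

/-- `dieZ S` is the set of finite words over `Fin m` in which `S` occurs exactly once
as a factor, namely as a suffix. -/
def dieZ {m : ℕ} (S : List (Fin m)) : Set (List (Fin m)) := {w | S <:+ w ∧ numOccs S w = 1}

/-- The lengths, shifted down by one, of the overlaps of `S`, i.e. of the nonempty words
that are simultaneously a prefix and a suffix of `S`.  The overlap of `S` of length
`i + 1` (for `i ∈ overlapLens S`) is `S.take (i + 1)`, so that summation over the set of
overlaps of `S` is summation of `S.take (i + 1)` over `i ∈ overlapLens S`. -/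
def overlapLens {m : ℕ} (S : List (Fin m)) : Finset ℕ :=
  (Finset.range S.length).filter fun i => S.take (i + 1) <:+ S

/-- The expected number of die rolls `E(S) = ∑_{w ∈ Z(S)} |w| P(w)` needed to produce `S`. -/
noncomputable def dieE {m : ℕ} (p : Fin m → ℝ) (S : List (Fin m)) : ℝ :=
  ∑' w : dieZ S, (w.1.length : ℝ) * dieP p w.1

open scoped ENNReal
open Filter Topology

section Telescoping

variable {a z : ℕ → ℝ≥0∞}

lemma sum_range_add_of_step (h : ∀ n, a n = z n + a (n + 1)) (i N : ℕ) :
    a i = ∑ n ∈ Finset.range N, z (i + n) + a (i + N) := by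
  induction N with
  | zero => simp
  | succ N ih => rw [Finset.sum_range_succ, add_assoc, ← add_assoc i, ← h, ← ih]

lemma tsum_le_of_step (h : ∀ n, a n = z n + a (n + 1)) : ∑' n, z n ≤ a 0 := by
  refine ENNReal.tsum_le_of_sum_range_le fun N => ?_
  rw [sum_range_add_of_step h 0 N]
  simp

lemma tsum_shift_eq_of_step (h : ∀ n, a n = z n + a (n + 1)) (ha : ∑' n, a n ≠ ∞) (i : ℕ) :
    ∑' n, z (i + n) = a i := by
  have h0 : Tendsto (fun N => a (i + N)) atTop (𝓝 0) :=
    (ENNReal.tendsto_atTop_zero_of_tsum_ne_top ha).comp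
      (tendsto_atTop_mono (fun N => Nat.le_add_left N i) tendsto_id)
  have h1 := (ENNReal.tendsto_nat_tsum fun n => z (i + n)).add h0
  rw [add_zero] at h1
  refine tendsto_nhds_unique h1 ?_
  simp_rw [← sum_range_add_of_step h i]
  exact tendsto_const_nhds

lemma tsum_succ_mul_of_step (h : ∀ n, a n = z n + a (n + 1)) (ha : ∑' n, a n ≠ ∞) :
    ∑' n : ℕ, ((n + 1 : ℕ) : ℝ≥0∞) * z n = ∑' n, a n := by
  have h1 (n : ℕ) : ((n + 1 : ℕ) : ℝ≥0∞) * z n = ∑' i, if i ≤ n then z n else 0 := by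
    rw [tsum_eq_sum (s := Finset.range (n + 1))]
    · rw [Finset.sum_congr rfl fun i hi => if_pos (Finset.mem_range_succ_iff.1 hi)]
      simp
    · intro i hi
      exact if_neg fun h => hi (Finset.mem_range_succ_iff.2 h)
  simp_rw [h1]
  rw [ENNReal.tsum_comm]
  refine tsum_congr fun i => ?_
  rw [← tsum_shift_eq_of_step h ha i,
    ← (add_right_injective i).tsum_eq (f := fun n => if i ≤ n then z n else 0)]
  · simp
  · intro n hn
    have : i ≤ n := by
      by_contra hlt
      simp [hlt] at hn
    exact ⟨n - i, by simp [this]⟩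

end Telescoping

section Words

variable {m : ℕ} {S w : List (Fin m)}

/-- The words that do not contain `S` as a factor. -/
def avoiding (S : List (Fin m)) : Set (List (Fin m)) := {w | ¬ S <:+: w}

lemma numOccs_eq_one_iff_of_suffix (hS : S ≠ []) (hw : S <:+ w) :
    numOccs S w = 1 ↔ w.dropLast ∈ avoiding S := by
  have hlen := hw.length_le
  have hpos := List.length_pos_of_ne_nil hS
  have hmem : w.length - S.length ∈
      (Finset.range (w.length + 1)).filter fun i => (w.drop i).take S.length = S := by
    rw [Finset.mem_filter, Finset.mem_range]
    refine ⟨by omega, ?_⟩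
    rw [← List.suffix_iff_eq_drop.1 hw, List.take_length]
  constructor
  · rintro h ⟨u, v, huv⟩
    obtain ⟨x, hx⟩ := Finset.card_eq_one.1 h
    have hl := congrArg List.length huv
    simp only [List.length_append, List.length_dropLast] at hl
    have hu : u.length ∈
        (Finset.range (w.length + 1)).filter fun i => (w.drop i).take S.length = S := by
      rw [Finset.mem_filter, Finset.mem_range]
      refine ⟨by omega, ?_⟩
      obtain ⟨r, hr⟩ := List.dropLast_prefix w
      rw [← hr, ← huv]
      simp [List.append_assoc]
    rw [hx, Finset.mem_singleton] at hmem hu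
    omega
  · intro h
    refine Finset.card_eq_one.2 ⟨_, Finset.eq_singleton_iff_unique_mem.2 ⟨hmem, fun i hi => ?_⟩⟩
    rw [Finset.mem_filter, Finset.mem_range] at hi
    obtain ⟨hi, hiS⟩ := hi
    have hl := congrArg List.length hiS
    simp only [List.length_take, List.length_drop] at hl
    by_contra hne
    refine h ⟨w.take i, (w.dropLast).drop (i + S.length), ?_⟩
    have : w.take i ++ S = w.dropLast.take (i + S.length) := by
      rw [List.dropLast_eq_take, List.take_take, min_eq_left (by omega), List.take_add, hiS]
    rw [this, List.take_append_drop]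

lemma mem_dieZ_iff (hS : S ≠ []) : w ∈ dieZ S ↔ S <:+ w ∧ w.dropLast ∈ avoiding S :=
  and_congr_right fun h => numOccs_eq_one_iff_of_suffix hS h

lemma avoiding_of_prefix {u : List (Fin m)} (h : w ∈ avoiding S) (hu : u <+: w) :
    u ∈ avoiding S := fun h' => h (h'.trans hu.isInfix)

/-- A one-letter extension of a word avoiding `S` either avoids `S` or ends in its only `S`. -/
lemma dropLast_mem_avoiding_iff (hS : S ≠ []) :
    w.dropLast ∈ avoiding S ↔ w ∈ dieZ S ∨ w ∈ avoiding S := by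
  rw [mem_dieZ_iff hS]
  constructor
  · intro h
    by_cases hw : w ∈ avoiding S
    · exact Or.inr hw
    refine Or.inl ⟨?_, h⟩
    obtain ⟨u, v, huv⟩ := not_not.1 hw
    rcases List.eq_nil_or_concat v with rfl | ⟨v, c, rfl⟩
    · exact ⟨u, by simpa using huv⟩
    · refine absurd ⟨u, v, ?_⟩ h
      rw [← huv]
      simp [← List.append_assoc]
  · rintro (h | h)
    · exact h.2
    · exact avoiding_of_prefix h (List.dropLast_prefix w)

lemma disjoint_dieZ_avoiding : Disjoint (dieZ S) (avoiding S) :=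
  Set.disjoint_left.2 fun _ h h' => h' h.1.isInfix

lemma dropLast_append_take {i : ℕ} (hi : i < S.length) :
    (w ++ S.take (i + 1)).dropLast = w ++ S.take i := by
  rw [List.take_succ_eq_append_getElem hi, ← List.append_assoc, List.dropLast_concat]

lemma avoiding_of_append_mem_dieZ {i : ℕ} (hi : i < S.length)
    (h : w ++ S.take (i + 1) ∈ dieZ S) : w ++ S.take i ∈ avoiding S := by
  have := ((mem_dieZ_iff (List.ne_nil_of_length_pos (by omega))).1 h).2
  rwa [dropLast_append_take hi] at this

/-- If `w` avoids `S`, then the first occurrence of `S` in `w ++ S` ends after exactly one overlap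
of `S`. -/
lemma existsUnique_overlap (hS : S ≠ []) (hw : w ∈ avoiding S) :
    ∃! i, i ∈ overlapLens S ∧ w ++ S.take (i + 1) ∈ dieZ S := by
  classical
  have hex : ∃ i, S <:+: w ++ S.take (i + 1) := by
    refine ⟨S.length, ?_⟩
    rw [List.take_of_length_le (by omega)]
    exact (List.suffix_append w S).isInfix
  have hlt : Nat.find hex < S.length := by
    have hpos := List.length_pos_of_ne_nil hS
    have : Nat.find hex ≤ S.length - 1 := Nat.find_min' hex (by
      rw [List.take_of_length_le (by omega)]
      exact (List.suffix_append w S).isInfix)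
    omega
  have hav : w ++ S.take (Nat.find hex) ∈ avoiding S := by
    rcases h : Nat.find hex with _ | n
    · simpa using hw
    · exact Nat.find_min hex (by omega)
  have hZ : w ++ S.take (Nat.find hex + 1) ∈ dieZ S := by
    rw [← dropLast_append_take hlt, dropLast_mem_avoiding_iff hS] at hav
    exact hav.resolve_right fun h => h (Nat.find_spec hex)
  refine ⟨Nat.find hex, ⟨?_, hZ⟩, ?_⟩
  · rw [overlapLens, Finset.mem_filter, Finset.mem_range]
    refine ⟨hlt, List.suffix_of_suffix_length_le (List.suffix_append _ _) hZ.1 ?_⟩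
    simp
  · rintro j ⟨hj, hjZ⟩
    have hjlt : j < S.length := Finset.mem_range.1 (Finset.mem_filter.1 hj).1
    by_contra hne
    have hle : Nat.find hex ≤ j := Nat.find_min' hex hjZ.1.isInfix
    refine avoiding_of_append_mem_dieZ hjlt hjZ ((Nat.find_spec hex).trans ?_)
    exact ((List.prefix_append_right_inj w).2
      (List.take_prefix_take_left (by omega))).isInfix

end Words

section Mass

variable {m : ℕ} {p : Fin m → ℝ} {S : List (Fin m)}

/-- The probability of a word, as an extended nonnegative real. -/
noncomputable def wordMass (p : Fin m → ℝ) (w : List (Fin m)) : ℝ≥0∞ := ENNReal.ofReal (dieP p w)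

/-- The total mass of the words of length `n` in the set `A`. -/
noncomputable def levelMass (p : Fin m → ℝ) (A : Set (List (Fin m))) (n : ℕ) : ℝ≥0∞ :=
  ∑' w, (A ∩ {w | w.length = n}).indicator (wordMass p) w

lemma dieP_pos (hp : ∀ i, 0 < p i) (w : List (Fin m)) : 0 < dieP p w := by
  refine List.prod_pos fun x hx => ?_
  obtain ⟨i, -, rfl⟩ := List.mem_map.1 hx
  exact hp i

lemma dieP_append (u v : List (Fin m)) : dieP p (u ++ v) = dieP p u * dieP p v := by
  simp [dieP]

lemma wordMass_append (hp : ∀ i, 0 < p i) (u v : List (Fin m)) :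
    wordMass p (u ++ v) = wordMass p u * wordMass p v := by
  rw [wordMass, dieP_append, ENNReal.ofReal_mul (dieP_pos hp u).le, wordMass, wordMass]

lemma wordMass_ne_zero (hp : ∀ i, 0 < p i) (w : List (Fin m)) : wordMass p w ≠ 0 :=
  (ENNReal.ofReal_pos.2 (dieP_pos hp w)).ne'

lemma wordMass_ne_top {w : List (Fin m)} : wordMass p w ≠ ∞ := ENNReal.ofReal_ne_top

lemma tsum_wordMass_singleton (hp : ∀ i, 0 < p i) (hsum : ∑ i, p i = 1) :
    ∑' c, wordMass p [c] = 1 := by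
  simp only [tsum_fintype, wordMass, dieP, List.map_cons, List.map_nil, List.prod_singleton]
  rw [← ENNReal.ofReal_sum_of_nonneg fun i _ => (hp i).le, hsum, ENNReal.ofReal_one]

lemma tsum_indicator_eq_tsum_levelMass (A : Set (List (Fin m))) (g : ℕ → ℝ≥0∞) :
    ∑' w, A.indicator (fun w => g w.length * wordMass p w) w = ∑' n, g n * levelMass p A n := by
  classical
  simp_rw [levelMass, ← ENNReal.tsum_mul_left]
  rw [ENNReal.tsum_comm]
  refine tsum_congr fun w => ?_
  rw [tsum_eq_single w.length]
  · by_cases hw : w ∈ A <;> simp [hw]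
  · intro n hn
    simp [hn.symm]

lemma levelMass_step (hp : ∀ i, 0 < p i) (hsum : ∑ i, p i = 1) (hS : S ≠ []) (n : ℕ) :
    levelMass p (avoiding S) n =
      levelMass p (dieZ S) (n + 1) + levelMass p (avoiding S) (n + 1) := by
  have hsnoc : Function.Injective fun x : List (Fin m) × Fin m => x.1 ++ [x.2] := by
    rintro ⟨u, c⟩ ⟨v, d⟩ h
    simpa using h
  have hdisj : Disjoint (dieZ S ∩ {w | w.length = n + 1})
      (avoiding S ∩ {w | w.length = n + 1}) :=
    disjoint_dieZ_avoiding.mono Set.inter_subset_left Set.inter_subset_left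
  have hunion : dieZ S ∩ {w | w.length = n + 1} ∪ avoiding S ∩ {w | w.length = n + 1} =
      {w | w.dropLast ∈ avoiding S ∧ w.length = n + 1} := by
    ext w
    simp only [Set.mem_ofPred_eq, dropLast_mem_avoiding_iff hS, Set.mem_union, Set.mem_inter_iff]
    tauto
  rw [levelMass, levelMass, levelMass, ← ENNReal.tsum_add,
    ← tsum_congr fun w => congrFun (Set.indicator_union_of_disjoint hdisj (wordMass p)) w,
    hunion,
    ← hsnoc.tsum_eq (f := Set.indicator {w | w.dropLast ∈ avoiding S ∧ w.length = n + 1} _),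
    ENNReal.tsum_prod']
  · refine tsum_congr fun w => ?_
    by_cases hw : w ∈ avoiding S ∩ {w | w.length = n}
    · have hw' : ∀ c, w ++ [c] ∈ {w | w.dropLast ∈ avoiding S ∧ w.length = n + 1} := by
        intro c
        simpa using hw
      simp only [Set.indicator_of_mem hw, Set.indicator_of_mem (hw' _), wordMass_append hp]
      rw [ENNReal.tsum_mul_left, tsum_wordMass_singleton hp hsum, mul_one]
    · have hw' : ∀ c, w ++ [c] ∉ {w | w.dropLast ∈ avoiding S ∧ w.length = n + 1} := by
        intro c
        simpa using hw
      simp only [Set.indicator_of_notMem hw, Set.indicator_of_notMem (hw' _), tsum_zero]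
  · intro w hw
    have hmem := Set.mem_of_indicator_ne_zero hw
    rcases List.eq_nil_or_concat w with rfl | ⟨u, c, rfl⟩
    · simp at hmem
    · exact ⟨(u, c), by simp⟩

lemma levelMass_dieZ_zero (hS : S ≠ []) : levelMass p (dieZ S) 0 = 0 := by
  refine ENNReal.tsum_eq_zero.2 fun w => Set.indicator_of_notMem ?_ _
  rintro ⟨h, h0⟩
  rw [List.eq_nil_of_length_eq_zero h0] at h
  exact hS (List.suffix_nil.1 h.1)

lemma levelMass_avoiding_zero (hS : S ≠ []) : levelMass p (avoiding S) 0 = 1 := by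
  rw [levelMass, tsum_eq_single []]
  · rw [Set.indicator_of_mem]
    · simp [wordMass, dieP]
    · exact ⟨fun h => hS (List.infix_nil.1 h), rfl⟩
  · intro w hw
    exact Set.indicator_of_notMem (fun h => hw (List.eq_nil_of_length_eq_zero h.2)) _

lemma tsum_append_take_mem_dieZ (hp : ∀ i, 0 < p i) {i : ℕ} (hi : i ∈ overlapLens S) :
    ∑' w, {w | w ++ S.take (i + 1) ∈ dieZ S}.indicator (wordMass p) w =
      (wordMass p (S.take (i + 1)))⁻¹ * ∑' w, (dieZ S).indicator (wordMass p) w := by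
  classical
  rw [← (List.append_left_injective (S.take (i + 1))).tsum_eq
    (f := (dieZ S).indicator (wordMass p)), ← ENNReal.tsum_mul_left]
  · refine tsum_congr fun w => ?_
    simp only [Set.indicator_apply, Set.mem_ofPred_eq, wordMass_append hp]
    split_ifs
    · rw [mul_comm, mul_assoc, ENNReal.mul_inv_cancel (wordMass_ne_zero hp _) wordMass_ne_top,
        mul_one]
    · simp
  · intro w hw
    obtain ⟨u, hu⟩ := (Finset.mem_filter.1 hi).2.trans (Set.mem_of_indicator_ne_zero hw).1
    exact ⟨u, hu⟩

lemma tsum_avoiding_eq (hp : ∀ i, 0 < p i) (hS : S ≠ []) :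
    ∑' w, (avoiding S).indicator (wordMass p) w =
      (∑ i ∈ overlapLens S, (wordMass p (S.take (i + 1)))⁻¹) *
        ∑' w, (dieZ S).indicator (wordMass p) w := by
  classical
  rw [Finset.sum_mul, ← Finset.sum_congr rfl fun i hi => tsum_append_take_mem_dieZ hp hi,
    ← Summable.tsum_finsetSum fun _ _ => ENNReal.summable]
  refine tsum_congr fun w => ?_
  by_cases hw : w ∈ avoiding S
  · obtain ⟨i, ⟨hi, hiZ⟩, huniq⟩ := existsUnique_overlap hS hw
    rw [Finset.sum_eq_single_of_mem i hi, Set.indicator_of_mem hw]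
    · exact (Set.indicator_of_mem (s := {w | w ++ S.take (i + 1) ∈ dieZ S}) hiZ
        (wordMass p)).symm
    · intro j hj hne
      refine Set.indicator_of_notMem (fun h => hne ?_) _
      exact huniq j ⟨hj, h⟩
  · rw [Set.indicator_of_notMem hw, Finset.sum_eq_zero]
    intro i hi
    refine Set.indicator_of_notMem (fun h => hw ?_) _
    exact avoiding_of_prefix (avoiding_of_append_mem_dieZ
      (Finset.mem_range.1 (Finset.mem_filter.1 hi).1) h) (List.prefix_append _ _)

/-- Conway's formula: the expected waiting time for `S` is the sum of the inverse probabilities of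
the overlaps of `S`. -/
theorem dieE_eq_sum_overlapLens (hp : ∀ i, 0 < p i) (hsum : ∑ i, p i = 1) (hS : S ≠ []) :
    dieE p S = ∑ i ∈ overlapLens S, (dieP p (S.take (i + 1)))⁻¹ := by
  have hmass (A : Set (List (Fin m))) :
      ∑' w, A.indicator (wordMass p) w = ∑' n, levelMass p A n := by
    simpa using tsum_indicator_eq_tsum_levelMass (p := p) A fun _ => 1
  have hstep := levelMass_step hp hsum hS
  have hZ : ∑' w, (dieZ S).indicator (wordMass p) w = ∑' n, levelMass p (dieZ S) (n + 1) := by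
    rw [hmass, tsum_eq_zero_add' ENNReal.summable, levelMass_dieZ_zero hS, zero_add]
  have hinv (i : ℕ) : (wordMass p (S.take (i + 1)))⁻¹ ≠ ∞ :=
    ENNReal.inv_ne_top.2 (wordMass_ne_zero hp _)
  have hA := tsum_avoiding_eq hp hS
  have hfin : ∑' n, levelMass p (avoiding S) n ≠ ∞ := by
    rw [← hmass, hA, hZ]
    refine ENNReal.mul_ne_top (ENNReal.sum_ne_top.2 fun i _ => hinv i) ?_
    refine ((tsum_le_of_step hstep).trans_lt ?_).ne
    rw [levelMass_avoiding_zero hS]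
    exact ENNReal.one_lt_top
  have hone : ∑' n, levelMass p (dieZ S) (n + 1) = 1 := by
    simpa [levelMass_avoiding_zero hS] using tsum_shift_eq_of_step hstep hfin 0
  have hE : ∑' w, (dieZ S).indicator (fun w => (w.length : ℝ≥0∞) * wordMass p w) w =
      ∑ i ∈ overlapLens S, (wordMass p (S.take (i + 1)))⁻¹ := by
    rw [tsum_indicator_eq_tsum_levelMass (dieZ S) fun n => (n : ℝ≥0∞),
      tsum_eq_zero_add' ENNReal.summable, levelMass_dieZ_zero hS, mul_zero, zero_add,
      tsum_succ_mul_of_step hstep hfin, ← hmass, hA, hZ, hone, mul_one]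
  have hterm (w : List (Fin m)) :
      (w.length : ℝ) * dieP p w = ((w.length : ℝ≥0∞) * wordMass p w).toReal := by
    simp [wordMass, ENNReal.toReal_ofReal (dieP_pos hp w).le]
  simp_rw [dieE, hterm]
  rw [← ENNReal.tsum_toReal_eq fun w =>
      ENNReal.mul_ne_top (ENNReal.natCast_ne_top _) wordMass_ne_top,
    tsum_subtype (dieZ S) fun w => (w.length : ℝ≥0∞) * wordMass p w, hE,
    ENNReal.toReal_sum fun i _ => hinv i]
  refine Finset.sum_congr rfl fun i _ => ?_
  rw [ENNReal.toReal_inv, wordMass, ENNReal.toReal_ofReal (dieP_pos hp _).le]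

lemma pow_length_le_dieP {q : ℝ} (hq : 0 ≤ q) (h : ∀ i, q ≤ p i) (w : List (Fin m)) :
    q ^ w.length ≤ dieP p w := by
  induction w with
  | nil => simp [dieP]
  | cons c w ih =>
    simp only [dieP, List.map_cons, List.prod_cons, List.length_cons, pow_succ'] at ih ⊢
    exact mul_le_mul (h c) ih (pow_nonneg hq _) (hq.trans (h c))

lemma overlapLens_replicate (k : ℕ) (t : Fin m) :
    overlapLens (List.replicate k t) = Finset.range k := by
  ext i
  simp only [overlapLens, Finset.mem_filter, Finset.mem_range, List.length_replicate,
    and_iff_left_iff_imp]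
  intro hi
  rw [List.take_replicate, List.suffix_replicate_iff]
  simp

end Mass

lemma sum_Icc_inv_pow {q : ℝ} (hq : q ≠ 0) (hq1 : q ≠ 1) (k : ℕ) :
    ∑ i ∈ Finset.Icc 1 k, (q ^ i)⁻¹ = (1 - q ^ k) / ((1 - q) * q ^ k) := by
  have h1 : 1 - q ≠ 0 := sub_ne_zero.2 hq1.symm
  induction k with
  | zero => simp
  | succ k ih =>
    rw [Finset.sum_Icc_succ_top (by omega), ih]
    field_simp
    ring

/-- If `p t = min {p_1, …, p_m}` then the maximum of `E(S)` over words `S` of length `k`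
equals `p^{-1} + ⋯ + p^{-k} = (1 - p^k)/((1-p) p^k)` (with `p = p t`), achieved at
`S = t^k`. -/
theorem stmt_15 (m : ℕ) (hm : 2 ≤ m) (p : Fin m → ℝ) (hp : ∀ i, 0 < p i)
    (hsum : ∑ i, p i = 1) (t : Fin m) (ht : ∀ i, p t ≤ p i) (k : ℕ) (hk : 1 ≤ k) :
    (∀ S : List (Fin m), S.length = k →
        dieE p S ≤ (1 - p t ^ k) / ((1 - p t) * p t ^ k)) ∧
      dieE p (List.replicate k t) = ∑ i ∈ Finset.Icc 1 k, (p t ^ i)⁻¹ ∧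
        (∑ i ∈ Finset.Icc 1 k, (p t ^ i)⁻¹) = (1 - p t ^ k) / ((1 - p t) * p t ^ k) := by
  have hlt : p t < 1 := by
    obtain ⟨s, hs⟩ : ∃ s, s ≠ t :=
      haveI : Nontrivial (Fin m) := Fin.nontrivial_iff_two_le.2 hm
      exists_ne t
    rw [← hsum]
    exact Finset.single_lt_sum hs (Finset.mem_univ t) (Finset.mem_univ s) (hp s)
      fun i _ _ => (hp i).le
  have hgeom := sum_Icc_inv_pow (hp t).ne' hlt.ne k
  have hshift : ∑ i ∈ Finset.Icc 1 k, (p t ^ i)⁻¹ = ∑ i ∈ Finset.range k, (p t ^ (i + 1))⁻¹ := by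
    rw [Finset.range_eq_Ico, Finset.sum_Ico_add' (fun i => (p t ^ i)⁻¹) 0 k 1]
    rfl
  refine ⟨fun S hS => ?_, ?_, hgeom⟩
  · rw [dieE_eq_sum_overlapLens hp hsum (List.ne_nil_of_length_pos (by omega)), ← hgeom, hshift,
      ← hS]
    refine (Finset.sum_le_sum fun i hi => ?_).trans
      (Finset.sum_le_sum_of_subset_of_nonneg (Finset.filter_subset _ _)
        fun i _ _ => (inv_pos.2 (pow_pos (hp t) _)).le)
    refine inv_anti₀ (pow_pos (hp t) _) ?_
    have hi' := Finset.mem_range.1 (Finset.mem_filter.1 hi).1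
    have := pow_length_le_dieP (hp t).le ht (S.take (i + 1))
    rwa [List.length_take, min_eq_left (by omega)] at this
  · rw [dieE_eq_sum_overlapLens hp hsum (List.ne_nil_of_length_pos (by simp; omega)),
      overlapLens_replicate, hshift]
    refine Finset.sum_congr rfl fun i hi => ?_
    have hi' := Finset.mem_range.1 hi
    rw [List.take_replicate, min_eq_left (by omega)]
    simp [dieP]
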